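/- arXiv:2410.19679 — 4 statements merged into one kernel-verified Lean document; each statement's English description precedes it below -/
import Mathlib

section
/- Let T be a bounded linear operator on a complex Hilbert space H and N a norm on B(H). If dw_N(T) = w_N(T), then either T = 0 or w_N(T) = max{N(Re(iT)), N(Re(-iT))}. -/
open ContinuousLinearMap Complex

variable {H : Type*} [NormedAddCommGroup H] [InnerProductSpace ℂ H] [CompleteSpace H]

/-- Real part of an operator: `Re(A) = (A + A*)/2`. -/
noncomputable def reOp (A : H →L[ℂ] H) : H →L[ℂ] H := (2 : ℂ)⁻¹ • (A + adjoint A)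

/-- Imaginary part of an operator: `Im(A) = (A - A*)/(2i)`. -/
noncomputable def imOp (A : H →L[ℂ] H) : H →L[ℂ] H := (2 * I)⁻¹ • (A - adjoint A)

/-- Modulus of an operator: `|A| = (A* A)^{1/2}`. -/
noncomputable def absOp (A : H →L[ℂ] H) : H →L[ℂ] H := CFC.sqrt (adjoint A * A)

/-- Generalized numerical radius. -/
noncomputable def wN (N : (H →L[ℂ] H) → ℝ) (T : H →L[ℂ] H) : ℝ :=
  ⨆ θ : ℝ, N (reOp (Complex.exp (θ * I) • T))

/-- Generalized Davis–Wielandt radius. -/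
noncomputable def dwN (N : (H →L[ℂ] H) → ℝ) (T : H →L[ℂ] H) : ℝ :=
  ⨆ θ : ℝ, Real.sqrt ((N (reOp (Complex.exp (θ * I) • T))) ^ 2
    + (N (reOp (Complex.exp (θ * I) • absOp T))) ^ 4)

theorem stmt_0 (N : (H →L[ℂ] H) → ℝ) (T : H →L[ℂ] H)
    (hN0 : ∀ A : H →L[ℂ] H, 0 ≤ N A)
    (hNeq : ∀ A : H →L[ℂ] H, N A = 0 → A = 0)
    (hNadd : ∀ A B : H →L[ℂ] H, N (A + B) ≤ N A + N B)
    (hNsmul : ∀ (c : ℂ) (A : H →L[ℂ] H), N (c • A) = ‖c‖ * N A) :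
    dwN N T = wN N T →
      T = 0 ∨ wN N T = max (N (reOp (I • T))) (N (reOp ((-I) • T))) := by
  intro h
  by_cases hT : T = 0
  · exact Or.inl hT
  right
  have hre_add : ∀ (z w : ℂ) (A : H →L[ℂ] H),
      reOp ((z + w) • A) = reOp (z • A) + reOp (w • A) := by
    intro z w A
    simp only [reOp, add_smul, map_add, smul_add]
    abel
  have hbd : ∀ (z : ℂ) (A : H →L[ℂ] H),
      N (reOp (z • A)) ≤ (N A + N (adjoint A)) * ‖z‖ := by
    intro z A
    have h1 := hNadd (z • A) (adjoint (z • A))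
    have h2 : adjoint (z • A) = (starRingEnd ℂ z) • adjoint A :=
      map_smulₛₗ adjoint z A
    have h3 : N (reOp (z • A)) = ‖(2 : ℂ)⁻¹‖ * N (z • A + adjoint (z • A)) := by
      rw [reOp, hNsmul]
    have h4 : ‖(2 : ℂ)⁻¹‖ = 1 / 2 := by norm_num
    have h0 := hN0 (z • A + adjoint (z • A))
    rw [h3, h4]
    have h5 : N (adjoint (z • A)) = ‖z‖ * N (adjoint A) := by
      rw [h2, hNsmul, RCLike.norm_conj]
    rw [h5, hNsmul] at h1
    linarith
  have hexp : ∀ θ : ℝ, ‖Complex.exp (θ * I)‖ = 1 := fun θ => Complex.norm_exp_ofReal_mul_I θ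
  have hbd1 : ∀ (θ : ℝ) (A : H →L[ℂ] H),
      N (reOp (Complex.exp (θ * I) • A)) ≤ N A + N (adjoint A) := by
    intro θ A
    have := hbd (Complex.exp (θ * I)) A
    rwa [hexp, mul_one] at this
  have hneg : N (reOp ((-I) • T)) = N (reOp (I • T)) := by
    have e : reOp ((-I) • T) = (-1 : ℂ) • reOp (I • T) := by
      simp [reOp]
    rw [e, hNsmul]; simp
  -- continuity and attainment on the circle
  have hcont : Continuous (fun z : ℂ => N (reOp (z • T))) := by
    have hC : 0 ≤ N T + N (adjoint T) := add_nonneg (hN0 _) (hN0 _)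
    refine (LipschitzWith.of_le_add_mul (⟨N T + N (adjoint T), hC⟩ : NNReal) ?_).continuous
    intro z w
    have h1 := hNadd (reOp (w • T)) (reOp ((z - w) • T))
    rw [← hre_add, add_sub_cancel] at h1
    have h2 := hbd (z - w) T
    rw [dist_eq_norm]
    exact h1.trans (add_le_add le_rfl h2)
  obtain ⟨z, hz, hmax⟩ := (isCompact_sphere (0 : ℂ) 1).exists_isMaxOn
    ⟨1, by simp⟩ hcont.continuousOn
  have hz1 : ‖z‖ = 1 := by simpa using hz
  obtain ⟨t, ht⟩ : ∃ t : ℝ, Complex.exp (t * I) = z := (Complex.norm_eq_one_iff z).1 hz1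
  have hw : wN N T = N (reOp (z • T)) := by
    apply le_antisymm
    · exact ciSup_le fun θ => hmax (by simp [hexp])
    · have hb : BddAbove (Set.range fun θ : ℝ => N (reOp (Complex.exp (θ * I) • T))) :=
        ⟨_, by rintro _ ⟨θ, rfl⟩; exact hbd1 θ T⟩
      have := le_ciSup hb t
      simp only [ht] at this
      exact this
  have hd : Real.sqrt ((N (reOp (z • T))) ^ 2 + (N (reOp (z • absOp T))) ^ 4) ≤ dwN N T := by
    have hb : BddAbove (Set.range fun θ : ℝ =>
        Real.sqrt ((N (reOp (Complex.exp (θ * I) • T))) ^ 2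
          + (N (reOp (Complex.exp (θ * I) • absOp T))) ^ 4)) := by
      refine ⟨Real.sqrt ((N T + N (adjoint T)) ^ 2
        + (N (absOp T) + N (adjoint (absOp T))) ^ 4), ?_⟩
      rintro _ ⟨θ, rfl⟩
      apply Real.sqrt_le_sqrt
      exact add_le_add (pow_le_pow_left₀ (hN0 _) (hbd1 _ _) _)
        (pow_le_pow_left₀ (hN0 _) (hbd1 _ _) _)
    have := le_ciSup hb t
    simp only [ht] at this
    exact this
  rw [h, hw, Real.sqrt_le_left (hN0 _)] at hd
  have h4 : N (reOp (z • absOp T)) = 0 := by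
    have : N (reOp (z • absOp T)) ^ 4 = 0 :=
      le_antisymm (by linarith) (pow_nonneg (hN0 _) _)
    exact pow_eq_zero_iff (by norm_num) |>.1 this
  have hsa : adjoint (absOp T) = absOp T := by
    have : IsSelfAdjoint (absOp T) := (CFC.sqrt_nonneg (adjoint T * T)).isSelfAdjoint
    exact this
  have habs : absOp T ≠ 0 := by
    intro h0
    have hp : (0 : H →L[ℂ] H) ≤ adjoint T * T := star_mul_self_nonneg T
    have h1 : absOp T * absOp T = adjoint T * T := CFC.sqrt_mul_sqrt_self _ hp
    rw [h0, zero_mul] at h1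
    have h2 : star T * T = 0 := h1.symm
    exact hT ((CStarRing.star_mul_self_eq_zero_iff T).1 h2)
  have hre : z.re = 0 := by
    have h5 := hNeq _ h4
    have h6 : reOp (z • absOp T) = (z.re : ℂ) • absOp T := by
      have e : adjoint (z • absOp T) = (starRingEnd ℂ z) • absOp T := by
        have e2 : adjoint (z • absOp T) = (starRingEnd ℂ z) • adjoint (absOp T) :=
          map_smulₛₗ adjoint z (absOp T)
        rwa [hsa] at e2
      rw [reOp, e, ← add_smul, smul_smul, Complex.add_conj]
      congr 1
      push_cast
      ring
    rw [h6] at h5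
    rcases smul_eq_zero.1 h5 with h7 | h7
    · exact_mod_cast h7
    · exact absurd h7 habs
  have him : z = I ∨ z = -I := by
    have h8 : z.im * z.im = 1 := by
      have := Complex.normSq_eq_norm_sq z
      rw [Complex.normSq_apply, hre, hz1] at this
      linarith
    rcases mul_self_eq_one_iff.1 h8 with h9 | h9
    · left; apply Complex.ext <;> simp [hre, h9]
    · right; apply Complex.ext <;> simp [hre, h9]
  rw [hneg, max_self, hw]
  rcases him with rfl | rfl
  · rfl
  · exact hneg
end

section
/- Let T be a bounded linear operator on a complex Hilbert space H and N a norm on B(H). Then dw_N(T) ≥ (1/2) sqrt( N(T)² + 2 N(|T|)⁴ + 2 |N(Re(T))² + N(|T|)⁴ − N(Im(T))²| ). -/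
open ContinuousLinearMap Complex

variable {H : Type*} [NormedAddCommGroup H] [InnerProductSpace ℂ H] [CompleteSpace H]

theorem N_reOp_exp_le (N : (H →L[ℂ] H) → ℝ)
    (hNadd : ∀ A B : H →L[ℂ] H, N (A + B) ≤ N A + N B)
    (hNsmul : ∀ (c : ℂ) (A : H →L[ℂ] H), N (c • A) = ‖c‖ * N A) (A : H →L[ℂ] H) (θ : ℝ) :
    N (reOp (Complex.exp (θ * I) • A)) ≤ N A + N (adjoint A) := by
  have h1 : ‖Complex.exp (θ * I)‖ = 1 := Complex.norm_exp_ofReal_mul_I θ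
  have h2 := hNadd (Complex.exp (θ * I) • A) (adjoint (Complex.exp (θ * I) • A))
  have h3 : adjoint (Complex.exp (θ * I) • A)
      = (starRingEnd ℂ) (Complex.exp (θ * I)) • adjoint A := map_smulₛₗ _ _ _
  rw [h3, hNsmul, hNsmul, RCLike.norm_conj, h1, one_mul, one_mul] at h2
  have h0 : 0 ≤ N (Complex.exp (θ * I) • A
      + (starRingEnd ℂ) (Complex.exp (θ * I)) • adjoint A) := by
    set B := Complex.exp (θ * I) • A + (starRingEnd ℂ) (Complex.exp (θ * I)) • adjoint A
    have e1 := hNadd B ((-1 : ℂ) • B)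
    have e2 := hNsmul 0 B
    have e3 : B + (-1 : ℂ) • B = (0 : ℂ) • B := by module
    rw [e3, e2, hNsmul] at e1
    simp at e1
    linarith
  rw [reOp, h3, hNsmul]
  have : ‖(2 : ℂ)⁻¹‖ = 1 / 2 := by simp
  rw [this]
  linarith

theorem reOp_absOp (T : H →L[ℂ] H) : adjoint (absOp T) = absOp T := by
  have h : IsSelfAdjoint (absOp T) := IsSelfAdjoint.of_nonneg (CFC.sqrt_nonneg _)
  exact h

theorem stmt_2 (N : (H →L[ℂ] H) → ℝ) (T : H →L[ℂ] H)
    (hN0 : ∀ A : H →L[ℂ] H, 0 ≤ N A)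
    (hNeq : ∀ A : H →L[ℂ] H, N A = 0 → A = 0)
    (hNadd : ∀ A B : H →L[ℂ] H, N (A + B) ≤ N A + N B)
    (hNsmul : ∀ (c : ℂ) (A : H →L[ℂ] H), N (c • A) = ‖c‖ * N A) :
    dwN N T ≥ (1 / 2) * Real.sqrt ((N T) ^ 2 + 2 * (N (absOp T)) ^ 4
      + 2 * |(N (reOp T)) ^ 2 + (N (absOp T)) ^ 4 - (N (imOp T)) ^ 2|) := by
  have hbdd : BddAbove (Set.range fun θ : ℝ =>
      Real.sqrt ((N (reOp (Complex.exp (θ * I) • T))) ^ 2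
        + (N (reOp (Complex.exp (θ * I) • absOp T))) ^ 4)) := by
    refine ⟨Real.sqrt ((N T + N (adjoint T)) ^ 2
      + (N (absOp T) + N (adjoint (absOp T))) ^ 4), ?_⟩
    rintro _ ⟨θ, rfl⟩
    have h1 := N_reOp_exp_le N hNadd hNsmul T θ
    have h2 := N_reOp_exp_le N hNadd hNsmul (absOp T) θ
    have h3 := hN0 (reOp (Complex.exp (θ * I) • T))
    have h4 := hN0 (reOp (Complex.exp (θ * I) • absOp T))
    dsimp only
    gcongr
  have hz : N 0 = 0 := by
    have := hNsmul 0 (0 : H →L[ℂ] H)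
    simpa using this
  have hA : Real.sqrt ((N (reOp T)) ^ 2 + (N (absOp T)) ^ 4) ≤ dwN N T := by
    have h := le_ciSup hbdd 0
    have e : reOp (absOp T) = absOp T := by
      rw [reOp, reOp_absOp]; module
    simpa [e, dwN] using h
  have hpi : Complex.exp (((Real.pi / 2 : ℝ) : ℂ) * I) = I := by
    push_cast
    exact Complex.exp_pi_div_two_mul_I
  have hI : (2 * I)⁻¹ = -((2 : ℂ)⁻¹ * I) := by
    rw [mul_inv, Complex.inv_I]; ring
  have hB : N (imOp T) ≤ dwN N T := by
    have h := le_ciSup hbdd (Real.pi / 2)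
    have e : reOp (I • absOp T) = 0 := by
      rw [reOp, map_smulₛₗ, reOp_absOp, Complex.conj_I]; module
    have e2 : reOp (I • T) = (-1 : ℂ) • imOp T := by
      rw [reOp, imOp, map_smulₛₗ, Complex.conj_I, hI]; module
    rw [hpi, e, e2, hNsmul, hz] at h
    simp only [norm_neg, norm_one, one_mul] at h
    rw [zero_pow (by norm_num), add_zero, Real.sqrt_sq (hN0 _)] at h
    exact h
  have hT : N T ≤ N (reOp T) + N (imOp T) := by
    have e : T = reOp T + I • imOp T := by
      have : I * (2 * I)⁻¹ = (2 : ℂ)⁻¹ := by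
        field_simp
      rw [reOp, imOp, smul_smul, this]; module
    have h := hNadd (reOp T) (I • imOp T)
    rw [← e, hNsmul, Complex.norm_I, one_mul] at h
    exact h
  have hd : 0 ≤ dwN N T := (hN0 _).trans hB
  have hA2 := (Real.sqrt_le_left hd).1 hA
  have hB2 : N (imOp T) ^ 2 ≤ dwN N T ^ 2 := pow_le_pow_left₀ (hN0 _) hB 2
  have hT2 : N T ^ 2 ≤ (N (reOp T) + N (imOp T)) ^ 2 := pow_le_pow_left₀ (hN0 _) hT 2
  have hs := sq_nonneg (N (reOp T) - N (imOp T))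
  have key : Real.sqrt ((N T) ^ 2 + 2 * (N (absOp T)) ^ 4
      + 2 * |(N (reOp T)) ^ 2 + (N (absOp T)) ^ 4 - (N (imOp T)) ^ 2|) ≤ 2 * dwN N T := by
    rw [Real.sqrt_le_left (by linarith)]
    rcases abs_cases ((N (reOp T)) ^ 2 + (N (absOp T)) ^ 4 - (N (imOp T)) ^ 2) with h | h <;>
      rw [h.1] <;> nlinarith
  linarith
end

section
/- Let T be a bounded linear operator on a complex Hilbert space H and N a norm on B(H). Then dw_N(T) ≥ (1/2) sqrt( N(T)² + 2 N(|T|)⁴ ). -/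
open ContinuousLinearMap Complex

variable {H : Type*} [NormedAddCommGroup H] [InnerProductSpace ℂ H] [CompleteSpace H]

theorem stmt_3 (N : (H →L[ℂ] H) → ℝ) (T : H →L[ℂ] H)
    (hN0 : ∀ A : H →L[ℂ] H, 0 ≤ N A)
    (hNeq : ∀ A : H →L[ℂ] H, N A = 0 → A = 0)
    (hNadd : ∀ A B : H →L[ℂ] H, N (A + B) ≤ N A + N B)
    (hNsmul : ∀ (c : ℂ) (A : H →L[ℂ] H), N (c • A) = ‖c‖ * N A) :
    dwN N T ≥ (1 / 2) * Real.sqrt ((N T) ^ 2 + 2 * (N (absOp T)) ^ 4) := by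
  have hre : ∀ A : H →L[ℂ] H, ∀ θ : ℝ, N (reOp (Complex.exp (θ * I) • A)) ≤ N A + N (adjoint A) := by
    intro A θ
    have h1 := hNadd (Complex.exp (θ * I) • A) (adjoint (Complex.exp (θ * I) • A))
    have h2 : adjoint (Complex.exp (θ * I) • A)
        = (starRingEnd ℂ) (Complex.exp (θ * I)) • adjoint A :=
      LinearIsometryEquiv.map_smulₛₗ adjoint _ _
    rw [h2, hNsmul, hNsmul, RCLike.norm_conj, Complex.norm_exp_ofReal_mul_I, ← h2] at h1
    unfold reOp
    rw [hNsmul]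
    have h3 : ‖(2 : ℂ)⁻¹‖ = 1 / 2 := by simp
    rw [h3]
    have := hN0 A
    have := hN0 (adjoint A)
    linarith
  have hbdd : BddAbove (Set.range fun θ : ℝ =>
      Real.sqrt ((N (reOp (Complex.exp (θ * I) • T))) ^ 2
        + (N (reOp (Complex.exp (θ * I) • absOp T))) ^ 4)) := by
    refine ⟨Real.sqrt ((N T + N (adjoint T)) ^ 2
      + (N (absOp T) + N (adjoint (absOp T))) ^ 4), ?_⟩
    rintro _ ⟨θ, rfl⟩
    apply Real.sqrt_le_sqrt
    exact add_le_add (pow_le_pow_left₀ (hN0 _) (hre T θ) 2)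
      (pow_le_pow_left₀ (hN0 _) (hre (absOp T) θ) 4)
  have h0 := le_ciSup hbdd 0
  have h1 := le_ciSup hbdd (Real.pi / 2)
  have hsa : adjoint (absOp T) = absOp T := by
    have : IsSelfAdjoint (absOp T) := (CFC.sqrt_nonneg _).isSelfAdjoint
    exact this
  have hP : reOp (absOp T) = absOp T := by
    unfold reOp
    rw [hsa, ← two_smul ℂ, smul_smul]
    norm_num
  have e1 : Complex.exp (((Real.pi / 2 : ℝ) : ℂ) * I) = I := by
    push_cast
    exact Complex.exp_pi_div_two_mul_I
  change _ ≤ dwN N T at h0 h1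
  simp only [e1] at h1
  simp only [Complex.ofReal_zero, zero_mul, Complex.exp_zero, one_smul, hP] at h0
  have hT : N T ≤ N (reOp T) + N (reOp (I • T)) := by
    have hd : T = reOp T + (-I) • reOp (I • T) := by
      unfold reOp
      have : adjoint (I • T) = (-I) • adjoint T := by
        rw [LinearIsometryEquiv.map_smulₛₗ adjoint, Complex.conj_I]
      rw [this]
      simp only [smul_add, smul_smul]
      have a1 : -I * (2⁻¹ * I) = 2⁻¹ := by linear_combination (-2⁻¹ : ℂ) * I_mul_I
      have a2 : -I * (2⁻¹ * -I) = -2⁻¹ := by linear_combination (2⁻¹ : ℂ) * I_mul_I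
      rw [a1, a2]
      module
    have h := hNadd (reOp T) ((-I) • reOp (I • T))
    rw [← hd, hNsmul] at h
    simpa using h
  have hM : 0 ≤ dwN N T := (Real.sqrt_nonneg _).trans h0
  rw [Real.sqrt_le_left hM] at h0 h1
  have hp := hN0 (reOp (I • absOp T))
  have hp4 : 0 ≤ N (reOp (I • absOp T)) ^ 4 := by positivity
  have ht2 : N T ^ 2 ≤ (N (reOp T) + N (reOp (I • T))) ^ 2 := pow_le_pow_left₀ (hN0 T) hT 2
  have key : Real.sqrt ((N T) ^ 2 + 2 * (N (absOp T)) ^ 4) ≤ 2 * dwN N T := by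
    rw [Real.sqrt_le_left (by linarith)]
    nlinarith [sq_nonneg (N (reOp T) - N (reOp (I • T)))]
  linarith
end

section
/- Let T be a bounded linear operator on a complex Hilbert space H and N an algebra norm on B(H). Then w_N(T) ≥ (1/2) max{ sqrt(N(|T|² + |T*|²)), sqrt(N(T² + (T*)²)) }. -/
open ContinuousLinearMap Complex

variable {H : Type*} [NormedAddCommGroup H] [InnerProductSpace ℂ H] [CompleteSpace H]

theorem stmt_7 (N : (H →L[ℂ] H) → ℝ) (T : H →L[ℂ] H)
    (hN0 : ∀ A : H →L[ℂ] H, 0 ≤ N A)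
    (hNeq : ∀ A : H →L[ℂ] H, N A = 0 → A = 0)
    (hNadd : ∀ A B : H →L[ℂ] H, N (A + B) ≤ N A + N B)
    (hNsmul : ∀ (c : ℂ) (A : H →L[ℂ] H), N (c • A) = ‖c‖ * N A)
    (hNmul : ∀ A B : H →L[ℂ] H, N (A * B) ≤ N A * N B) :
    wN N T ≥ (1 / 2) * max (Real.sqrt (N (absOp T ^ 2 + absOp (adjoint T) ^ 2)))
      (Real.sqrt (N (T ^ 2 + (adjoint T) ^ 2))) := by
  have hbdd : BddAbove (Set.range fun θ : ℝ => N (reOp (Complex.exp (θ * I) • T))) := by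
    refine ⟨‖(2 : ℂ)⁻¹‖ * (N T + N (adjoint T)), ?_⟩
    rintro _ ⟨θ, rfl⟩
    have h1 : ‖Complex.exp (θ * I)‖ = 1 := Complex.norm_exp_ofReal_mul_I θ
    simp only [reOp, hNsmul]
    refine mul_le_mul_of_nonneg_left ?_ (norm_nonneg _)
    refine (hNadd _ _).trans ?_
    rw [LinearIsometryEquiv.map_smulₛₗ, hNsmul, hNsmul, h1, RCLike.norm_conj, h1, one_mul, one_mul]
  have hw0 : 0 ≤ wN N T := Real.iSup_nonneg fun θ => hN0 _
  have hA : N ((2 : ℂ)⁻¹ • (T + adjoint T)) ≤ wN N T := by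
    have := le_ciSup hbdd 0
    simpa [reOp, wN] using this
  have hB : N ((2 : ℂ)⁻¹ • (I • (T - adjoint T))) ≤ wN N T := by
    have : N (reOp (Complex.exp ((Real.pi / 2 : ℝ) * I) • T)) ≤ wN N T :=
      le_ciSup hbdd (Real.pi / 2)
    have e : Complex.exp (((Real.pi / 2 : ℝ) : ℂ) * I) = I := by
      push_cast
      exact Complex.exp_pi_div_two_mul_I
    simp only [e, reOp, LinearIsometryEquiv.map_smulₛₗ, Complex.conj_I] at this
    rw [smul_sub, sub_eq_add_neg, ← neg_smul]
    exact this
  generalize hAd : (2 : ℂ)⁻¹ • (T + adjoint T) = A at hA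
  generalize hBd : (2 : ℂ)⁻¹ • (I • (T - adjoint T)) = B at hB
  have hAA : N (A * A) ≤ wN N T ^ 2 := by
    nlinarith [hNmul A A, hN0 A]
  have hBB : N (B * B) ≤ wN N T ^ 2 := by
    nlinarith [hNmul B B, hN0 B]
  have key : ∀ X : H →L[ℂ] H, ∀ c : ℂ, ‖c‖ = 2 → X = (2 : ℂ) • (A * A) + c • (B * B) →
      (1 / 2) * Real.sqrt (N X) ≤ wN N T := by
    intro X c hc hX
    have h := hNadd ((2 : ℂ) • (A * A)) (c • (B * B))
    rw [← hX, hNsmul, hNsmul, hc, Complex.norm_ofNat] at h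
    have : Real.sqrt (N X) ≤ 2 * wN N T := Real.sqrt_le_iff.2 ⟨by linarith, by nlinarith⟩
    linarith
  have habs : ∀ S : H →L[ℂ] H, absOp S ^ 2 = adjoint S * S := by
    intro S
    unfold absOp
    exact CFC.sq_sqrt _ (by
      have := star_mul_self_nonneg S
      rwa [ContinuousLinearMap.star_eq_adjoint] at this)
  have hAA' : A * A = (4 : ℂ)⁻¹ • ((T + adjoint T) * (T + adjoint T)) := by
    rw [← hAd, smul_mul_smul_comm]; norm_num
  have hBB' : B * B = (-(4 : ℂ)⁻¹) • ((T - adjoint T) * (T - adjoint T)) := by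
    rw [← hBd, smul_smul, smul_mul_smul_comm]
    congr 1
    linear_combination (4 : ℂ)⁻¹ * Complex.I_mul_I
  rw [ge_iff_le, mul_max_of_nonneg _ _ (by norm_num)]
  refine max_le (key _ 2 (by simp) ?_) (key _ (-2) (by simp) ?_)
  · rw [habs, habs, adjoint_adjoint, hAA', hBB']
    simp only [mul_add, add_mul, mul_sub, sub_mul]
    module
  · rw [hAA', hBB']
    simp only [mul_add, add_mul, mul_sub, sub_mul, pow_two]
    module
end
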